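/- arXiv:1902.04853 — 2 statements merged into one kernel-verified Lean document; each statement's English description precedes it below -/
import Mathlib

section
/- Let ν, d > 0 and let S, D be symmetric real 3×3 matrices. Then the following two conditions are equivalent: (i) if S ≠ O then D = (d/(2ν))·S/|S|, and if S = O then |D| ≤ d/(2ν); (ii) (2ν|D| − d)⁺ + | 2ν|S|·D − d·S | = 0. -/
/-- Frobenius norm of a real 3×3 matrix: `|A|² = tr(A²)` for symmetric `A`. -/
noncomputable def frobNorm (A : Matrix (Fin 3) (Fin 3) ℝ) : ℝ :=
  Real.sqrt (∑ i, ∑ j, (A i j) ^ 2)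

theorem frobNorm_nonneg (A : Matrix (Fin 3) (Fin 3) ℝ) : 0 ≤ frobNorm A :=
  Real.sqrt_nonneg _

theorem frobNorm_eq_zero_iff (A : Matrix (Fin 3) (Fin 3) ℝ) : frobNorm A = 0 ↔ A = 0 := by
  have hrow (i : Fin 3) : 0 ≤ ∑ j, A i j ^ 2 := Finset.sum_nonneg fun j _ => sq_nonneg (A i j)
  rw [frobNorm, Real.sqrt_eq_zero (Finset.sum_nonneg fun i _ => hrow i),
    Finset.sum_eq_zero_iff_of_nonneg fun i _ => hrow i]
  simp only [Finset.sum_eq_zero_iff_of_nonneg fun _ _ => sq_nonneg _, Finset.mem_univ,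
    true_imp_iff, sq_eq_zero_iff, ← Matrix.ext_iff, Matrix.zero_apply]

theorem frobNorm_smul (c : ℝ) (A : Matrix (Fin 3) (Fin 3) ℝ) :
    frobNorm (c • A) = |c| * frobNorm A := by
  simp only [frobNorm, Matrix.smul_apply, smul_eq_mul, mul_pow, ← Finset.mul_sum]
  rw [Real.sqrt_mul (sq_nonneg c), Real.sqrt_sq_eq_abs]

/-- Euler/rigid like response as a single scalar implicit constitutive equation. -/
theorem statement3 (ν d : ℝ) (hν : 0 < ν) (hd : 0 < d)
    (S D : Matrix (Fin 3) (Fin 3) ℝ) (hSsym : S.IsSymm) (hDsym : D.IsSymm) :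
    ((S ≠ 0 → D = (d / (2 * ν) / frobNorm S) • S) ∧ (S = 0 → frobNorm D ≤ d / (2 * ν))) ↔
      max (2 * ν * frobNorm D - d) 0 + frobNorm ((2 * ν * frobNorm S) • D - d • S) = 0 := by
  rw [add_eq_zero_iff_of_nonneg (le_max_right _ _) (frobNorm_nonneg _), max_eq_right_iff,
    frobNorm_eq_zero_iff, sub_eq_zero, sub_nonpos, ← le_div_iff₀' (by positivity : 0 < 2 * ν)]
  by_cases hS : S = 0
  · have hS0 : frobNorm S = 0 := (frobNorm_eq_zero_iff S).2 hS
    rw [hS0]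
    simp [hS]
  · have hpos : 0 < frobNorm S :=
      (frobNorm_nonneg S).lt_of_ne' (mt (frobNorm_eq_zero_iff S).1 hS)
    have hc : 2 * ν * frobNorm S ≠ 0 := by positivity
    simp only [ne_eq, hS, not_false_eq_true, true_imp_iff, false_imp_iff, and_true]
    constructor
    · intro hD
      constructor
      · rw [hD, frobNorm_smul, abs_of_pos (by positivity), div_mul_cancel₀ _ hpos.ne']
      · rw [hD, smul_smul]
        congr 1
        field_simp
    · rintro ⟨-, h⟩
      rw [div_div, div_eq_inv_mul, mul_smul, ← h, inv_smul_smul₀ hc]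
end

section
/- Let D ⊂ ℝ^M be a measurable set, let r ∈ (1, ∞) and r' = r/(r−1), and let G be a subset of Sym(d)×Sym(d) (pairs of symmetric real d×d matrices) that is monotone, i.e. (S₁−S₂):(D₁−D₂) ≥ 0 for all (S₁,D₁), (S₂,D₂) ∈ G, and maximal monotone, i.e. whenever (S−S̃):(D−D̃) ≥ 0 for all (S̃,D̃) ∈ G then (S,D) ∈ G. Suppose measurable matrix-valued functions Sⁿ, S ∈ L^{r'}(D; Sym(d)) and Dⁿ, D ∈ L^{r}(D; Sym(d)) satisfy: (Sⁿ(x), Dⁿ(x)) ∈ G for almost every x ∈ D and every n; Dⁿ ⇀ D weakly in L^r(D; Sym(d)) (that is, ∫_D Dⁿ : Φ → ∫_D D : Φ for every Φ ∈ L^{r'}(D; Sym(d))); Sⁿ ⇀ S weakly in L^{r'}(D; Sym(d)); and limsup_{n→∞} ∫_D Sⁿ : Dⁿ ≤ ∫_D S : D. Then (S(x), D(x)) ∈ G for almost every x ∈ D. -/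
open MeasureTheory Filter

/-- Frobenius norm of a real k×k matrix. -/
noncomputable def frobNormG {k : ℕ} (A : Matrix (Fin k) (Fin k) ℝ) : ℝ :=
  Real.sqrt (∑ i, ∑ j, (A i j) ^ 2)

/-- Entrywise product `A : B = Σᵢⱼ Aᵢⱼ Bᵢⱼ`. -/
def mdotG {k : ℕ} (A B : Matrix (Fin k) (Fin k) ℝ) : ℝ := ∑ i, ∑ j, A i j * B i j

section Duality

variable {α : Type*} [MeasurableSpace α] {μ : Measure α} {p q : ℝ}

/-- Uniform boundedness principle for a weakly bounded sequence of `L^p` functions acting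
on `L^q`. -/
lemma exists_forall_abs_integral_mul_le (hpq : p.HolderConjugate q) {h : ℕ → α → ℝ}
    (hh : ∀ n, MemLp (h n) (ENNReal.ofReal p) μ)
    (hb : ∀ φ : α → ℝ, Measurable φ → MemLp φ (ENNReal.ofReal q) μ →
      ∃ C, ∀ n, |∫ x, h n x * φ x ∂μ| ≤ C) :
    ∃ C, ∀ n (φ : α → ℝ), MemLp φ (ENNReal.ofReal q) μ →
      |∫ x, h n x * φ x ∂μ| ≤ C * (eLpNorm φ (ENNReal.ofReal q) μ).toReal := by
  have := hpq.ennrealOfReal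
  have : Fact (1 ≤ ENNReal.ofReal p) := ⟨by simpa using hpq.lt.le⟩
  have : Fact (1 ≤ ENNReal.ofReal q) := ⟨by simpa using hpq.symm.lt.le⟩
  let T : ℕ → Lp ℝ (ENNReal.ofReal q) μ →L[ℝ] ℝ := fun n =>
    (ContinuousLinearMap.mul ℝ ℝ).lpPairing μ (ENNReal.ofReal p) (ENNReal.ofReal q)
      ((hh n).toLp (h n))
  have hT : ∀ n φ, T n φ = ∫ x, h n x * φ x ∂μ := by
    intro n φ
    simp only [T, ContinuousLinearMap.lpPairing_eq_integral]
    refine integral_congr_ae ?_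
    filter_upwards [(hh n).coeFn_toLp] with x hx
    simp [hx]
  obtain ⟨C, hC⟩ := banach_steinhaus (g := T) (fun φ => by
    obtain ⟨C, hC⟩ := hb φ (Lp.stronglyMeasurable φ).measurable (Lp.memLp φ)
    exact ⟨C, fun n => by rw [hT, Real.norm_eq_abs]; exact hC n⟩)
  refine ⟨C, fun n φ hφ => ?_⟩
  have h1 := (T n).le_of_opNorm_le (hC n) (hφ.toLp φ)
  rw [hT, Lp.norm_toLp, Real.norm_eq_abs] at h1
  convert h1 using 2
  refine integral_congr_ae ?_
  filter_upwards [hφ.coeFn_toLp] with x hx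
  simp [hx]

lemma eLpNorm_toReal_le_of_forall_abs_integral_mul_le (hpq : p.HolderConjugate q) {h : α → ℝ}
    (hm : Measurable h) (hh : MemLp h (ENNReal.ofReal p) μ) {C : ℝ}
    (hC : ∀ φ : α → ℝ, MemLp φ (ENNReal.ofReal q) μ →
      |∫ x, h x * φ x ∂μ| ≤ C * (eLpNorm φ (ENNReal.ofReal q) μ).toReal) :
    (eLpNorm h (ENNReal.ofReal p) μ).toReal ≤ max C 0 := by
  have hp := hpq.pos
  have hq := hpq.symm.pos
  have hp0 : ENNReal.ofReal p ≠ 0 := by simpa using hp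
  have hq0 : ENNReal.ofReal q ≠ 0 := by simpa using hq
  let φ : α → ℝ := fun x => h x * |h x| ^ (p - 2)
  have hφm : Measurable φ := by fun_prop
  have habs : ∀ x, |φ x| = |h x| ^ (p - 1) := by
    intro x
    rcases eq_or_ne (h x) 0 with h0 | h0
    · simp [φ, h0, Real.zero_rpow (sub_ne_zero.2 hpq.lt.ne')]
    · have := abs_pos.2 h0
      rw [abs_mul, abs_of_nonneg (Real.rpow_nonneg (abs_nonneg _) _),
        ← Real.rpow_one_add' this.le (by linarith [hpq.lt])]
      congr 1; ring
  have hφq : ∀ x, ‖φ x‖ ^ q = ‖h x‖ ^ p := by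
    intro x
    rw [Real.norm_eq_abs, habs, ← Real.rpow_mul (abs_nonneg _), hpq.sub_one_mul_conj,
      Real.norm_eq_abs]
  have hmul : ∀ x, h x * φ x = ‖h x‖ ^ p := by
    intro x
    rcases eq_or_ne (h x) 0 with h0 | h0
    · simp [h0, Real.zero_rpow hp.ne']
    · have := abs_pos.2 h0
      rw [← mul_assoc, ← abs_mul_abs_self (h x), Real.norm_eq_abs, ← sq, ← Real.rpow_natCast,
        ← Real.rpow_add this]
      congr 1; push_cast; ring
  have hφL : MemLp φ (ENNReal.ofReal q) μ := by
    rw [← integrable_norm_rpow_iff hφm.aestronglyMeasurable hq0 ENNReal.ofReal_ne_top]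
    have := hh.integrable_norm_rpow hp0 ENNReal.ofReal_ne_top
    simp only [ENNReal.toReal_ofReal hp.le] at this
    simpa only [ENNReal.toReal_ofReal hq.le, hφq] using this
  have key := hC φ hφL
  rw [hh.eLpNorm_eq_integral_rpow_norm hp0 ENNReal.ofReal_ne_top]
  rw [hφL.eLpNorm_eq_integral_rpow_norm hq0 ENNReal.ofReal_ne_top] at key
  simp only [hmul, hφq, ENNReal.toReal_ofReal hp.le, ENNReal.toReal_ofReal hq.le] at key ⊢
  have hN : 0 ≤ ∫ x, ‖h x‖ ^ p ∂μ := integral_nonneg fun x => by positivity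
  set N := ∫ x, ‖h x‖ ^ p ∂μ
  rw [abs_of_nonneg hN, ENNReal.toReal_ofReal (by positivity)] at key
  rw [ENNReal.toReal_ofReal (by positivity)]
  rcases hN.eq_or_lt with h0 | h0
  · rw [← h0, Real.zero_rpow (by simpa using hp.ne')]
    exact le_max_right _ _
  · refine le_max_of_le_left ?_
    have h1 : N ^ p⁻¹ * N ^ q⁻¹ = N := by
      rw [← Real.rpow_add h0, hpq.inv_add_inv_eq_one, Real.rpow_one]
    exact le_of_mul_le_mul_right (h1.trans_le key) (by positivity)

/-- Two weakly bounded sequences in dual Lebesgue spaces have bounded pairings. -/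
lemma exists_forall_abs_integral_mul_le_of_weakly_bounded (hpq : p.HolderConjugate q)
    {g h : ℕ → α → ℝ} (hgm : ∀ n, Measurable (g n))
    (hg : ∀ n, MemLp (g n) (ENNReal.ofReal q) μ) (hh : ∀ n, MemLp (h n) (ENNReal.ofReal p) μ)
    (hgb : ∀ φ : α → ℝ, Measurable φ → MemLp φ (ENNReal.ofReal p) μ →
      ∃ C, ∀ n, |∫ x, g n x * φ x ∂μ| ≤ C)
    (hhb : ∀ φ : α → ℝ, Measurable φ → MemLp φ (ENNReal.ofReal q) μ →
      ∃ C, ∀ n, |∫ x, h n x * φ x ∂μ| ≤ C) :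
    ∃ C, ∀ n, |∫ x, h n x * g n x ∂μ| ≤ C := by
  obtain ⟨C, hC⟩ := exists_forall_abs_integral_mul_le hpq hh hhb
  obtain ⟨C', hC'⟩ := exists_forall_abs_integral_mul_le hpq.symm hg hgb
  refine ⟨max C 0 * max C' 0, fun n => (hC n _ (hg n)).trans ?_⟩
  gcongr
  · exact le_max_left _ _
  · exact eLpNorm_toReal_le_of_forall_abs_integral_mul_le hpq.symm (hgm n) (hg n) (hC' n)

end Duality

section FrobeniusProduct

variable {k : ℕ}

lemma mdotG_sub_left (P Q R : Matrix (Fin k) (Fin k) ℝ) :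
    mdotG (P - Q) R = mdotG P R - mdotG Q R := by
  simp [mdotG, sub_mul, Finset.sum_sub_distrib]

lemma mdotG_sub_right (P Q R : Matrix (Fin k) (Fin k) ℝ) :
    mdotG P (Q - R) = mdotG P Q - mdotG P R := by
  simp [mdotG, mul_sub, Finset.sum_sub_distrib]

lemma mdotG_comm (P Q : Matrix (Fin k) (Fin k) ℝ) : mdotG P Q = mdotG Q P := by
  simp [mdotG, mul_comm]

@[simp]
lemma mdotG_zero (P : Matrix (Fin k) (Fin k) ℝ) : mdotG P 0 = 0 := by simp [mdotG]

lemma mdotG_symmPart {P : Matrix (Fin k) (Fin k) ℝ} (hP : P.IsSymm)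
    (Q : Matrix (Fin k) (Fin k) ℝ) :
    mdotG P ((1 / 2 : ℝ) • (Q + Q.transpose)) = mdotG P Q := by
  have h : mdotG P Q.transpose = mdotG P Q := by
    unfold mdotG
    rw [Finset.sum_comm]
    refine Finset.sum_congr rfl fun i _ => Finset.sum_congr rfl fun j _ => ?_
    rw [Matrix.transpose_apply, hP.apply]
  have h2 : mdotG P ((1 / 2 : ℝ) • (Q + Q.transpose))
      = (1 / 2) * (mdotG P Q + mdotG P Q.transpose) := by
    simp only [mdotG, Matrix.smul_apply, Matrix.add_apply, smul_eq_mul, Finset.mul_sum,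
      ← Finset.sum_add_distrib]
    refine Finset.sum_congr rfl fun i _ => Finset.sum_congr rfl fun j _ => by ring
  rw [h2, h]; ring

lemma mdotG_single (P : Matrix (Fin k) (Fin k) ℝ) (i j : Fin k) (c : ℝ) :
    mdotG P (Matrix.single i j c) = P i j * c := by
  unfold mdotG
  rw [Finset.sum_eq_single i, Finset.sum_eq_single j]
  · simp
  · intro j' _ hj; simp [hj.symm]
  · simp
  · intro i' _ hi; simp [hi.symm]
  · simp

lemma frobNormG_nonneg (P : Matrix (Fin k) (Fin k) ℝ) : 0 ≤ frobNormG P := Real.sqrt_nonneg _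

lemma abs_apply_le_frobNormG (P : Matrix (Fin k) (Fin k) ℝ) (i j : Fin k) :
    |P i j| ≤ frobNormG P := by
  refine Real.abs_le_sqrt ?_
  calc P i j ^ 2 ≤ ∑ j', P i j' ^ 2 :=
        Finset.single_le_sum (f := fun j' => P i j' ^ 2) (fun _ _ => sq_nonneg _)
          (Finset.mem_univ j)
    _ ≤ _ := Finset.single_le_sum (f := fun i' => ∑ j', P i' j' ^ 2)
          (fun _ _ => Finset.sum_nonneg fun _ _ => sq_nonneg _) (Finset.mem_univ i)

lemma frobNormG_le_sum_abs (P : Matrix (Fin k) (Fin k) ℝ) :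
    frobNormG P ≤ ∑ i, ∑ j, |P i j| := by
  unfold frobNormG
  rw [← Fintype.sum_prod_type' (f := fun i j => P i j ^ 2),
    ← Fintype.sum_prod_type' (f := fun i j => |P i j|)]
  refine Real.sqrt_le_iff.2 ⟨Finset.sum_nonneg fun _ _ => abs_nonneg _, ?_⟩
  simpa using Finset.sum_sq_le_sq_sum_of_nonneg (s := Finset.univ)
    (f := fun x : Fin k × Fin k => |P x.1 x.2|) (fun _ _ => abs_nonneg _)

variable {α : Type*} [MeasurableSpace α] {μ : Measure α} {p q : ℝ}
  {F H : α → Matrix (Fin k) (Fin k) ℝ}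

lemma measurable_frobNormG (hF : ∀ i j, Measurable fun x => F x i j) :
    Measurable fun x => frobNormG (F x) := by
  unfold frobNormG; fun_prop

lemma memLp_apply_of_integrable_frobNormG_rpow (hp : 0 < p)
    (hF : ∀ i j, Measurable fun x => F x i j)
    (h : Integrable (fun x => frobNormG (F x) ^ p) μ) (i j : Fin k) :
    MemLp (fun x => F x i j) (ENNReal.ofReal p) μ := by
  have h1 : MemLp (fun x => frobNormG (F x)) (ENNReal.ofReal p) μ := by
    rw [← integrable_norm_rpow_iff (measurable_frobNormG hF).aestronglyMeasurable
      (by simpa using hp) ENNReal.ofReal_ne_top]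
    simpa [ENNReal.toReal_ofReal hp.le, abs_of_nonneg, frobNormG_nonneg] using h
  exact h1.of_le (hF i j).aestronglyMeasurable (ae_of_all _ fun x =>
    (abs_apply_le_frobNormG (F x) i j).trans (le_abs_self _))

lemma integrable_frobNormG_rpow (hp : 0 < p) (hF : ∀ i j, Measurable fun x => F x i j)
    (h : ∀ i j, MemLp (fun x => F x i j) (ENNReal.ofReal p) μ) :
    Integrable (fun x => frobNormG (F x) ^ p) μ := by
  have h1 : MemLp (fun x => frobNormG (F x)) (ENNReal.ofReal p) μ := by
    refine MemLp.of_le (g := fun x => ∑ i, ∑ j, |F x i j|)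
      (memLp_finsetSum _ fun i _ => memLp_finsetSum _ fun j _ => (h i j).abs)
      (measurable_frobNormG hF).aestronglyMeasurable (ae_of_all _ fun x => ?_)
    rw [Real.norm_eq_abs, Real.norm_eq_abs, abs_of_nonneg (frobNormG_nonneg _)]
    exact (frobNormG_le_sum_abs _).trans (le_abs_self _)
  have := h1.integrable_norm_rpow (by simpa using hp) ENNReal.ofReal_ne_top
  simpa [ENNReal.toReal_ofReal hp.le, abs_of_nonneg, frobNormG_nonneg] using this

lemma integrable_mdotG (hpq : p.HolderConjugate q)
    (hF : ∀ i j, MemLp (fun x => F x i j) (ENNReal.ofReal p) μ)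
    (hH : ∀ i j, MemLp (fun x => H x i j) (ENNReal.ofReal q) μ) :
    Integrable (fun x => mdotG (F x) (H x)) μ := by
  have := hpq.ennrealOfReal
  exact integrable_finsetSum _ fun i _ => integrable_finsetSum _ fun j _ =>
    (hF i j).integrable_mul (hH i j)

lemma integral_mdotG_sub_sub {P P' Q Q' : α → Matrix (Fin k) (Fin k) ℝ}
    (hpq : p.HolderConjugate q)
    (hP : ∀ i j, MemLp (fun x => P x i j) (ENNReal.ofReal p) μ)
    (hQ : ∀ i j, MemLp (fun x => Q x i j) (ENNReal.ofReal q) μ)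
    (hP' : ∀ i j, MemLp (fun x => P' x i j) (ENNReal.ofReal p) μ)
    (hQ' : ∀ i j, MemLp (fun x => Q' x i j) (ENNReal.ofReal q) μ) :
    ∫ x, mdotG (P x - P' x) (Q x - Q' x) ∂μ
      = ∫ x, mdotG (P x) (Q x) ∂μ - ∫ x, mdotG (P x) (Q' x) ∂μ
        - ∫ x, mdotG (P' x) (Q x) ∂μ + ∫ x, mdotG (P' x) (Q' x) ∂μ := by
  have h1 := integrable_mdotG hpq hP hQ
  have h2 := integrable_mdotG hpq hP hQ'
  have h3 := integrable_mdotG hpq hP' hQ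
  have h4 := integrable_mdotG hpq hP' hQ'
  rw [← integral_sub h1 h2, ← integral_sub (by exact h1.sub h2) h3,
    ← integral_add (by exact (h1.sub h2).sub h3) h4]
  refine integral_congr_ae (ae_of_all _ fun x => ?_)
  simp only [mdotG_sub_left, mdotG_sub_right]
  ring

/-- Testing against symmetric fields on the whole space controls integrals over subsets
against arbitrary fields, as long as the sequence is symmetric. -/
lemma tendsto_setIntegral_mdotG {Fn : ℕ → α → Matrix (Fin k) (Fin k) ℝ} (hq : 0 < q)
    (hFn : ∀ n, ∀ᵐ x ∂μ, (Fn n x).IsSymm) (hF : ∀ x, (F x).IsSymm)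
    (hw : ∀ Φ : α → Matrix (Fin k) (Fin k) ℝ,
      (∀ i j, Measurable fun x => Φ x i j) → (∀ x, (Φ x).IsSymm) →
      Integrable (fun x => frobNormG (Φ x) ^ q) μ →
      Tendsto (fun n => ∫ x, mdotG (Fn n x) (Φ x) ∂μ) atTop (nhds (∫ x, mdotG (F x) (Φ x) ∂μ)))
    {C : Set α} (hC : MeasurableSet C) (hH : ∀ i j, Measurable fun x => H x i j)
    (hHL : ∀ i j, MemLp (fun x => H x i j) (ENNReal.ofReal q) (μ.restrict C)) :
    Tendsto (fun n => ∫ x in C, mdotG (Fn n x) (H x) ∂μ) atTop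
      (nhds (∫ x in C, mdotG (F x) (H x) ∂μ)) := by
  let Φ : α → Matrix (Fin k) (Fin k) ℝ :=
    C.indicator fun x => (1 / 2 : ℝ) • (H x + (H x).transpose)
  have hΦij : ∀ i j, (fun x => Φ x i j)
      = C.indicator fun x => (1 / 2 : ℝ) * (H x i j + H x j i) := by
    intro i j; ext x
    by_cases hx : x ∈ C <;> simp [Φ, hx, mul_add]
  have hΦm : ∀ i j, Measurable fun x => Φ x i j := by
    intro i j
    rw [hΦij]
    exact (((hH i j).add (hH j i)).const_mul _).indicator hC
  have hΦs : ∀ x, (Φ x).IsSymm := by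
    intro x
    ext i j
    by_cases hx : x ∈ C <;> simp [Φ, hx, add_comm]
  have hΦL : ∀ i j, MemLp (fun x => Φ x i j) (ENNReal.ofReal q) μ := by
    intro i j
    rw [hΦij, memLp_indicator_iff_restrict hC]
    exact ((hHL i j).add (hHL j i)).const_mul _
  have heq : ∀ P : α → Matrix (Fin k) (Fin k) ℝ, (∀ᵐ x ∂μ, (P x).IsSymm) →
      ∫ x, mdotG (P x) (Φ x) ∂μ = ∫ x in C, mdotG (P x) (H x) ∂μ := by
    intro P hP
    rw [← integral_indicator hC]
    refine integral_congr_ae ?_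
    filter_upwards [hP] with x hx
    by_cases hxC : x ∈ C
    · simp only [Φ, hxC, Set.indicator_of_mem, mdotG_symmPart hx]
    · simp [Φ, hxC]
  have := hw Φ hΦm hΦs (integrable_frobNormG_rpow hq hΦm hΦL)
  rw [heq F (ae_of_all _ hF)] at this
  exact this.congr fun n => heq _ (hFn n)

/-- Weak convergence of symmetric fields gives weak boundedness of each entry. -/
lemma exists_forall_abs_integral_apply_mul_le {Fn : ℕ → α → Matrix (Fin k) (Fin k) ℝ}
    (hw : ∀ Φ : α → Matrix (Fin k) (Fin k) ℝ, (∀ i j, Measurable fun x => Φ x i j) →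
      (∀ i j, MemLp (fun x => Φ x i j) (ENNReal.ofReal q) μ) →
      Tendsto (fun n => ∫ x, mdotG (Fn n x) (Φ x) ∂μ) atTop (nhds (∫ x, mdotG (F x) (Φ x) ∂μ)))
    (i j : Fin k) {φ : α → ℝ} (hφ : Measurable φ) (hφL : MemLp φ (ENNReal.ofReal q) μ) :
    ∃ C, ∀ n, |∫ x, Fn n x i j * φ x ∂μ| ≤ C := by
  have key := hw (fun x => Matrix.single i j (φ x))
    (fun i' j' => by
      by_cases h : i = i' ∧ j = j' <;> simp [h, hφ])
    (fun i' j' => by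
      by_cases h : i = i' ∧ j = j' <;> simp [h, hφL])
  simp only [mdotG_single] at key
  obtain ⟨C, hC⟩ := key.abs.bddAbove_range
  exact ⟨C, fun n => hC ⟨n, rfl⟩⟩

end FrobeniusProduct

/-- Lower semicontinuity of the diagonal terms for a doubly indexed monotonicity inequality. -/
lemma eventually_lt_of_monotone_pairing {v α β : ℕ → ℝ} {a b : ℕ → ℕ → ℝ} {I ε : ℝ}
    (hpos : ∀ n m, 0 ≤ v n - a n m - b n m + v m)
    (ha : ∀ m, Tendsto (fun n => a n m) atTop (nhds (α m)))
    (hb : ∀ m, Tendsto (fun n => b n m) atTop (nhds (β m)))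
    (hα : Tendsto α atTop (nhds I)) (hβ : Tendsto β atTop (nhds I)) (hε : 0 < ε) :
    ∀ᶠ n in atTop, I - ε < v n := by
  by_contra hcon
  have hfreq : ∃ᶠ n in atTop, v n ≤ I - ε := by simpa [Filter.Frequently] using hcon
  have h1 : ∀ᶠ m in atTop, I + I - ε / 2 < α m + β m :=
    (hα.add hβ).eventually (lt_mem_nhds (by linarith))
  obtain ⟨m, hm, hm'⟩ := (hfreq.and_eventually h1).exists
  have h2 : ∀ᶠ n in atTop, α m + β m - ε / 2 < a n m + b n m :=
    ((ha m).add (hb m)).eventually (lt_mem_nhds (by linarith))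
  obtain ⟨n, hn, hn'⟩ := (hfreq.and_eventually h2).exists
  linarith [hpos n m]

/-- A closed inequality over a set of parameters that holds almost everywhere for each
parameter holds almost everywhere for all parameters at once. -/
lemma ae_forall_mem_mdotG_nonneg {k : ℕ} {α : Type*} [MeasurableSpace α] {μ : Measure α}
    {S D : α → Matrix (Fin k) (Fin k) ℝ}
    {G : Set (Matrix (Fin k) (Fin k) ℝ × Matrix (Fin k) (Fin k) ℝ)}
    (h : ∀ p ∈ G, ∀ᵐ x ∂μ, 0 ≤ mdotG (S x - p.1) (D x - p.2)) :
    ∀ᵐ x ∂μ, ∀ p ∈ G, 0 ≤ mdotG (S x - p.1) (D x - p.2) := by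
  have : SecondCountableTopology (Matrix (Fin k) (Fin k) ℝ) :=
    inferInstanceAs (SecondCountableTopology (Fin k → Fin k → ℝ))
  obtain ⟨s, hs, hsd⟩ := TopologicalSpace.exists_countable_dense G
  have := (ae_ball_iff hs).2 fun p (_ : p ∈ s) => h p.1 p.2
  filter_upwards [this] with x hx p hp
  have hclosed : IsClosed {p : G | 0 ≤ mdotG (S x - p.1.1) (D x - p.1.2)} := by
    refine isClosed_le continuous_const ?_
    simp only [mdotG, Matrix.sub_apply]
    have h1 : ∀ i j, Continuous fun p : G => p.1.1 i j := fun i j =>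
      (continuous_fst.comp continuous_subtype_val).matrix_elem i j
    have h2 : ∀ i j, Continuous fun p : G => p.1.2 i j := fun i j =>
      (continuous_snd.comp continuous_subtype_val).matrix_elem i j
    exact continuous_finsetSum _ fun i _ => continuous_finsetSum _ fun j _ =>
      (continuous_const.sub (h1 i j)).mul (continuous_const.sub (h2 i j))
  exact hclosed.closure_subset_iff.2 (fun p hp => hx p hp) (hsd ⟨p, hp⟩)


/-- Graph convergence lemma: a maximal monotone graph
`G ⊂ Sym(k) × Sym(k)` is stable under weak `L^{r'}`/`L^r` convergence of the
stress/strain-rate sequences, provided the `limsup` of the dissipation does not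
exceed the dissipation of the limits. -/
theorem statement19 (M k : ℕ) (r r' : ℝ) (hr : 1 < r) (hr' : r' = r / (r - 1))
    (A : Set (EuclideanSpace ℝ (Fin M))) (hA : MeasurableSet A)
    (G : Set (Matrix (Fin k) (Fin k) ℝ × Matrix (Fin k) (Fin k) ℝ))
    (hGsym : ∀ p ∈ G, p.1.IsSymm ∧ p.2.IsSymm)
    (hGmono : ∀ p ∈ G, ∀ q ∈ G, 0 ≤ mdotG (p.1 - q.1) (p.2 - q.2))
    (hGmax : ∀ S D : Matrix (Fin k) (Fin k) ℝ, S.IsSymm → D.IsSymm →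
      (∀ p ∈ G, 0 ≤ mdotG (S - p.1) (D - p.2)) → (S, D) ∈ G)
    (Sn Dn : ℕ → EuclideanSpace ℝ (Fin M) → Matrix (Fin k) (Fin k) ℝ)
    (S D : EuclideanSpace ℝ (Fin M) → Matrix (Fin k) (Fin k) ℝ)
    (hSnmeas : ∀ n i j, Measurable (fun x => Sn n x i j))
    (hDnmeas : ∀ n i j, Measurable (fun x => Dn n x i j))
    (hSmeas : ∀ i j, Measurable (fun x => S x i j))
    (hDmeas : ∀ i j, Measurable (fun x => D x i j))
    (hSsym : ∀ x, (S x).IsSymm) (hDsym : ∀ x, (D x).IsSymm)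
    (hSnLp : ∀ n, IntegrableOn (fun x => frobNormG (Sn n x) ^ r') A)
    (hSLp : IntegrableOn (fun x => frobNormG (S x) ^ r') A)
    (hDnLp : ∀ n, IntegrableOn (fun x => frobNormG (Dn n x) ^ r) A)
    (hDLp : IntegrableOn (fun x => frobNormG (D x) ^ r) A)
    (hGae : ∀ n, ∀ᵐ x ∂(volume.restrict A), (Sn n x, Dn n x) ∈ G)
    (hDweak : ∀ Φ : EuclideanSpace ℝ (Fin M) → Matrix (Fin k) (Fin k) ℝ,
      (∀ i j, Measurable (fun x => Φ x i j)) → (∀ x, (Φ x).IsSymm) →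
      IntegrableOn (fun x => frobNormG (Φ x) ^ r') A →
      Tendsto (fun n => ∫ x in A, mdotG (Dn n x) (Φ x)) atTop
        (nhds (∫ x in A, mdotG (D x) (Φ x))))
    (hSweak : ∀ Φ : EuclideanSpace ℝ (Fin M) → Matrix (Fin k) (Fin k) ℝ,
      (∀ i j, Measurable (fun x => Φ x i j)) → (∀ x, (Φ x).IsSymm) →
      IntegrableOn (fun x => frobNormG (Φ x) ^ r) A →
      Tendsto (fun n => ∫ x in A, mdotG (Sn n x) (Φ x)) atTop
        (nhds (∫ x in A, mdotG (S x) (Φ x))))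
    (hlimsup : limsup (fun n => ∫ x in A, mdotG (Sn n x) (Dn n x)) atTop
      ≤ ∫ x in A, mdotG (S x) (D x)) :
    ∀ᵐ x ∂(volume.restrict A), (S x, D x) ∈ G := by
  have hpq : r.HolderConjugate r' := (Real.holderConjugate_iff_eq_conjExponent hr).2 hr'
  have hr0 := hpq.pos
  have hr0' := hpq.symm.pos
  set μ := (volume : Measure (EuclideanSpace ℝ (Fin M))).restrict A
  have hSnL n := memLp_apply_of_integrable_frobNormG_rpow hr0' (hSnmeas n) (hSnLp n)
  have hDnL n := memLp_apply_of_integrable_frobNormG_rpow hr0 (hDnmeas n) (hDnLp n)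
  have hSL := memLp_apply_of_integrable_frobNormG_rpow hr0' hSmeas hSLp
  have hDL := memLp_apply_of_integrable_frobNormG_rpow hr0 hDmeas hDLp
  have hwS : ∀ C : Set (EuclideanSpace ℝ (Fin M)), MeasurableSet C → ∀ Φ :
      EuclideanSpace ℝ (Fin M) → Matrix (Fin k) (Fin k) ℝ,
      (∀ i j, Measurable fun x => Φ x i j) →
      (∀ i j, MemLp (fun x => Φ x i j) (ENNReal.ofReal r) (μ.restrict C)) →
      Tendsto (fun n => ∫ x in C, mdotG (Sn n x) (Φ x) ∂μ) atTop
        (nhds (∫ x in C, mdotG (S x) (Φ x) ∂μ)) := fun C hC Φ hΦ hΦL =>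
    tendsto_setIntegral_mdotG hr0 (fun n => (hGae n).mono fun x hx => (hGsym _ hx).1) hSsym
      hSweak hC hΦ hΦL
  have hwD : ∀ C : Set (EuclideanSpace ℝ (Fin M)), MeasurableSet C → ∀ Φ :
      EuclideanSpace ℝ (Fin M) → Matrix (Fin k) (Fin k) ℝ,
      (∀ i j, Measurable fun x => Φ x i j) →
      (∀ i j, MemLp (fun x => Φ x i j) (ENNReal.ofReal r') (μ.restrict C)) →
      Tendsto (fun n => ∫ x in C, mdotG (Φ x) (Dn n x) ∂μ) atTop
        (nhds (∫ x in C, mdotG (Φ x) (D x) ∂μ)) := fun C hC Φ hΦ hΦL => by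
    simpa only [mdotG_comm (Φ _)] using
      tendsto_setIntegral_mdotG hr0' (fun n => (hGae n).mono fun x hx => (hGsym _ hx).2) hDsym
        hDweak hC hΦ hΦL
  have hlower : ∀ C : Set (EuclideanSpace ℝ (Fin M)), MeasurableSet C → ∀ ε > 0,
      ∀ᶠ n in atTop, ∫ x in C, mdotG (S x) (D x) ∂μ - ε
        < ∫ x in C, mdotG (Sn n x) (Dn n x) ∂μ := by
    intro C hC ε hε
    refine eventually_lt_of_monotone_pairing
      (a := fun n m => ∫ x in C, mdotG (Sn n x) (Dn m x) ∂μ)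
      (b := fun n m => ∫ x in C, mdotG (Sn m x) (Dn n x) ∂μ) (fun n m => ?_)
      (fun m => hwS C hC _ (hDnmeas m) fun i j => (hDnL m i j).restrict C)
      (fun m => hwD C hC _ (hSnmeas m) fun i j => (hSnL m i j).restrict C)
      (hwD C hC _ hSmeas fun i j => (hSL i j).restrict C)
      (hwS C hC _ hDmeas fun i j => (hDL i j).restrict C) hε
    rw [← integral_mdotG_sub_sub hpq.symm (fun i j => (hSnL n i j).restrict C)
      (fun i j => (hDnL n i j).restrict C) (fun i j => (hSnL m i j).restrict C)
      (fun i j => (hDnL m i j).restrict C)]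
    refine integral_nonneg_of_ae (ae_restrict_of_ae ?_)
    filter_upwards [hGae n, hGae m] with x hx hy
    exact hGmono _ hx _ hy
  -- `limsup` in `ℝ` takes a default value on sequences that are unbounded above
  have hbdd : IsBoundedUnder (· ≤ ·) atTop fun n => ∫ x, mdotG (Sn n x) (Dn n x) ∂μ := by
    have hij : ∀ i j, ∃ C, ∀ n, |∫ x, Sn n x i j * Dn n x i j ∂μ| ≤ C := fun i j =>
      exists_forall_abs_integral_mul_le_of_weakly_bounded hpq.symm
        (fun n => hDnmeas n i j) (fun n => hDnL n i j) (fun n => hSnL n i j)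
        (fun φ hφ hφL => exists_forall_abs_integral_apply_mul_le (F := D)
          (fun Φ hΦ hΦL => by
            simpa only [mdotG_comm (Φ _), Measure.restrict_univ] using
              hwD Set.univ .univ Φ hΦ (by simpa using hΦL)) i j hφ hφL)
        (fun φ hφ hφL => exists_forall_abs_integral_apply_mul_le (F := S)
          (fun Φ hΦ hΦL => by
            simpa only [Measure.restrict_univ] using
              hwS Set.univ .univ Φ hΦ (by simpa using hΦL)) i j hφ hφL)
    choose C hC using hij
    have := hpq.symm.ennrealOfReal
    have hprod : ∀ n i j, Integrable (fun x => Sn n x i j * Dn n x i j) μ := fun n i j =>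
      (hSnL n i j).integrable_mul (hDnL n i j)
    refine isBoundedUnder_of ⟨∑ i, ∑ j, C i j, fun n => ?_⟩
    simp only [mdotG]
    rw [integral_finsetSum _ fun i _ => integrable_finsetSum _ fun j _ => hprod n i j]
    refine Finset.sum_le_sum fun i _ => ?_
    rw [integral_finsetSum _ fun j _ => hprod n i j]
    exact Finset.sum_le_sum fun j _ => (le_abs_self _).trans (hC i j n)
  have hSDint : Integrable (fun x => mdotG (S x) (D x)) μ := integrable_mdotG hpq.symm hSL hDL
  have hupper : ∀ C : Set (EuclideanSpace ℝ (Fin M)), MeasurableSet C → ∀ ε > 0,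
      ∀ᶠ n in atTop, ∫ x in C, mdotG (Sn n x) (Dn n x) ∂μ
        < ∫ x in C, mdotG (S x) (D x) ∂μ + ε := by
    intro C hC ε hε
    have h1 : ∀ᶠ n in atTop, ∫ x, mdotG (Sn n x) (Dn n x) ∂μ
        < ∫ x, mdotG (S x) (D x) ∂μ + ε / 2 :=
      eventually_lt_of_limsup_lt (hlimsup.trans_lt (by linarith)) hbdd
    filter_upwards [h1, hlower Cᶜ hC.compl (ε / 2) (by linarith)] with n hn hn'
    have h2 := integral_add_compl hC hSDint
    have h3 := integral_add_compl hC (integrable_mdotG hpq.symm (hSnL n) (hDnL n))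
    linarith
  have hset : ∀ p ∈ G, ∀ C : Set (EuclideanSpace ℝ (Fin M)), MeasurableSet C → μ C < ⊤ →
      0 ≤ ∫ x in C, mdotG (S x - p.1) (D x - p.2) ∂μ := by
    intro p hp C hC hμC
    have : IsFiniteMeasure (μ.restrict C) := ⟨by simpa using hμC⟩
    have h1 := (hwS C hC (fun _ => p.2) (fun _ _ => measurable_const)
      fun _ _ => memLp_const _).add
      (hwD C hC (fun _ => p.1) (fun _ _ => measurable_const) fun _ _ => memLp_const _)
    rw [integral_mdotG_sub_sub (P' := fun _ => p.1) (Q' := fun _ => p.2) hpq.symm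
      (fun i j => (hSL i j).restrict C)
      (fun i j => (hDL i j).restrict C) (fun _ _ => memLp_const _) fun _ _ => memLp_const _]
    refine le_of_forall_pos_le_add fun ε hε => ?_
    obtain ⟨n, hn, hn'⟩ := ((hupper C hC (ε / 2) (by linarith)).and
      (h1.eventually (lt_mem_nhds (sub_lt_self _ (half_pos hε))))).exists
    have h2 := integral_mdotG_sub_sub (P' := fun _ => p.1) (Q' := fun _ => p.2) hpq.symm
      (fun i j => (hSnL n i j).restrict C) (fun i j => (hDnL n i j).restrict C)
      (fun _ _ => memLp_const _) fun _ _ => memLp_const _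
    have h3 : 0 ≤ ∫ x in C, mdotG (Sn n x - p.1) (Dn n x - p.2) ∂μ :=
      integral_nonneg_of_ae (ae_restrict_of_ae ((hGae n).mono fun x hx => hGmono _ hx _ hp))
    linarith
  have hae : ∀ p ∈ G, ∀ᵐ x ∂μ, 0 ≤ mdotG (S x - p.1) (D x - p.2) := by
    intro p hp
    refine ae_nonneg_of_forall_setIntegral_nonneg_of_sigmaFinite (fun C hC hμC => ?_)
      (hset p hp)
    have : IsFiniteMeasure (μ.restrict C) := ⟨by simpa using hμC⟩
    exact integrable_mdotG hpq.symm
      (fun i j => ((hSL i j).restrict C).sub (memLp_const (p.1 i j)))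
      (fun i j => ((hDL i j).restrict C).sub (memLp_const (p.2 i j)))
  filter_upwards [ae_forall_mem_mdotG_nonneg hae] with x hx
  exact hGmax _ _ (hSsym x) (hDsym x) hx
end
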